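/- Let p be an odd prime, G a powerful p-group, N ≤ G^p with N of exponent at most p^2, and let x, y ∈ N with x^p = 1 and y^p = 1. Then x and y commute. -/

import Mathlib

/-- For a subgroup `H` of `G`, the subgroup generated by `n`-th powers of elements of `H`. -/
def sgPow {G : Type*} [Group G] (H : Subgroup G) (n : ℕ) : Subgroup G :=
  Subgroup.closure {x | ∃ h ∈ H, h ^ n = x}

section OmegaSubgroups

open Subgroup
open scoped commutatorElement

section Collection

variable {G : Type*} [Group G]

theorem pow_mul_of_commutator_commute {a b d : G} (h : b * a = d * (a * b)) (hb : Commute d b)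
    (n : ℕ) : b ^ n * a = d ^ n * (a * b ^ n) := by
  induction n with
  | zero => simp
  | succ n ih =>
    calc b ^ (n + 1) * a = b ^ n * (b * a) := by rw [pow_succ, mul_assoc]
      _ = b ^ n * d * a * b := by rw [h]; group
      _ = d * b ^ n * a * b := by rw [(hb.pow_right n).eq]
      _ = d * (b ^ n * a) * b := by group
      _ = d * d ^ n * a * b ^ n * b := by rw [ih]; group
      _ = d ^ (n + 1) * (a * b ^ (n + 1)) := by rw [pow_succ' d, pow_succ b]; group

/-- The power formula for two elements whose commutator commutes with both of them. -/
theorem mul_pow_of_commutator_commute {a b d : G} (h : b * a = d * (a * b)) (ha : Commute d a)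
    (hb : Commute d b) (n : ℕ) : (a * b) ^ n = d ^ n.choose 2 * (a ^ n * b ^ n) := by
  induction n with
  | zero => simp
  | succ n ih =>
    have hd : Commute (a ^ n) (d ^ n) := (ha.pow_pow n n).symm
    calc (a * b) ^ (n + 1) = d ^ n.choose 2 * (a ^ n * (b ^ n * a) * b) := by
          rw [pow_succ, ih]; group
      _ = d ^ n.choose 2 * (a ^ n * d ^ n * (a * b ^ n) * b) := by
          rw [pow_mul_of_commutator_commute h hb]; group
      _ = d ^ n.choose 2 * (d ^ n * a ^ n * (a * b ^ n) * b) := by rw [hd.eq]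
      _ = d ^ (n + 1).choose 2 * (a ^ (n + 1) * b ^ (n + 1)) := by
          rw [Nat.choose_succ_succ' n 1, Nat.choose_one_right, Nat.add_comm n, pow_add, pow_succ a,
            pow_succ b]
          group

theorem mul_pow_eq_of_commutator_pow_eq_one {p : ℕ} (hp : p.Prime) (hodd : Odd p) {a b : G}
    (ha : Commute ⁅b, a⁆ a) (hb : Commute ⁅b, a⁆ b) (hd : ⁅b, a⁆ ^ p = 1) :
    (a * b) ^ p = a ^ p * b ^ p := by
  have h2 : 2 < p := lt_of_le_of_ne hp.two_le (by rintro rfl; exact absurd hodd (by decide))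
  obtain ⟨k, hk⟩ := hp.dvd_choose_self two_ne_zero h2
  rw [mul_pow_of_commutator_commute (by rw [commutatorElement_def]; group) ha hb, hk, pow_mul, hd,
    one_pow, one_mul]

theorem commutatorElement_pow_left_of_commute {a b : G} (hb : Commute ⁅b, a⁆ b) (n : ℕ) : ⁅b ^ n, a⁆ = ⁅b, a⁆ ^ n := by
  rw [commutatorElement_def (b ^ n), pow_mul_of_commutator_commute (d := ⁅b, a⁆)
    (by rw [commutatorElement_def b]; group) hb]
  group

/-- If `c = ⁅a⁻¹, g⁻¹⁆` has order dividing `p` and `⁅c, a⁆` commutes with `c` and `a`, then `a ^ p`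
commutes with `g`. -/
theorem commute_pow_of_commutator_commute {p : ℕ} (hp : p.Prime) (hodd : Odd p) {a g : G}
    (ha : Commute ⁅⁅a⁻¹, g⁻¹⁆, a⁆ a) (hc : Commute ⁅⁅a⁻¹, g⁻¹⁆, a⁆ ⁅a⁻¹, g⁻¹⁆)
    (hcp : ⁅a⁻¹, g⁻¹⁆ ^ p = 1) : Commute (a ^ p) g := by
  have hd : ⁅⁅a⁻¹, g⁻¹⁆, a⁆ ^ p = 1 := by
    rw [← commutatorElement_pow_left_of_commute hc, hcp, commutatorElement_one_left]
  have h := mul_pow_eq_of_commutator_pow_eq_one hp hodd ha hc hd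
  have hconj : a * ⁅a⁻¹, g⁻¹⁆ = g⁻¹ * a * g⁻¹⁻¹ := by rw [commutatorElement_def]; group
  rw [hcp, mul_one, hconj, conj_pow, inv_inv] at h
  exact (eq_mul_of_inv_mul_eq (by rwa [← mul_assoc]) : a ^ p * g = g * a ^ p)

end Collection

section PowerSubgroup

variable {G : Type*} [Group G]

theorem pow_mem_sgPow {H : Subgroup G} {n : ℕ} {h : G} (hh : h ∈ H) : h ^ n ∈ sgPow H n :=
  subset_closure ⟨h, hh, rfl⟩

theorem sgPow_le_iff {H K : Subgroup G} {n : ℕ} : sgPow H n ≤ K ↔ ∀ h ∈ H, h ^ n ∈ K := by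
  refine ⟨fun h x hx => h (pow_mem_sgPow hx), fun h => (closure_le K).2 ?_⟩
  rintro _ ⟨x, hx, rfl⟩
  exact h x hx

theorem sgPow_le (H : Subgroup G) (n : ℕ) : sgPow H n ≤ H :=
  sgPow_le_iff.2 fun _ hh => H.pow_mem hh n

theorem sgPow_mono {H K : Subgroup G} (h : H ≤ K) (n : ℕ) : sgPow H n ≤ sgPow K n :=
  sgPow_le_iff.2 fun _ hx => pow_mem_sgPow (h hx)

theorem map_sgPow {G' : Type*} [Group G'] (f : G →* G') (H : Subgroup G) (n : ℕ) :
    (sgPow H n).map f = sgPow (H.map f) n := by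
  apply le_antisymm
  · rw [map_le_iff_le_comap, sgPow_le_iff]
    intro h hh
    rw [mem_comap, map_pow]
    exact pow_mem_sgPow (mem_map_of_mem f hh)
  · rw [sgPow_le_iff]
    rintro _ ⟨h, hh, rfl⟩
    rw [← map_pow]
    exact mem_map_of_mem f (pow_mem_sgPow hh)

instance sgPow_normal (H : Subgroup G) [hH : H.Normal] (n : ℕ) : (sgPow H n).Normal where
  conj_mem x hx g := by
    have : sgPow H n ≤ (sgPow H n).comap (MulAut.conj g).toMonoidHom := by
      rw [sgPow_le_iff]
      intro h hh
      rw [mem_comap, map_pow]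
      exact pow_mem_sgPow (hH.conj_mem h hh g)
    exact this hx

theorem map_subtype_sgPow_top (H : Subgroup G) (n : ℕ) :
    (sgPow (⊤ : Subgroup H) n).map H.subtype = sgPow H n := by
  rw [map_sgPow, ← MonoidHom.range_eq_map, range_subtype]

theorem commutator_top_le_sgPow_of_le {H : Subgroup G} {n : ℕ} (h : ⁅H, H⁆ ≤ sgPow H n) :
    ⁅(⊤ : Subgroup H), (⊤ : Subgroup H)⁆ ≤ sgPow ⊤ n := by
  rw [← map_le_map_iff_of_injective H.subtype_injective, map_subtype_sgPow_top, map_commutator,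
    ← MonoidHom.range_eq_map, range_subtype]
  exact h

theorem commutator_top_le_sgPow_of_surjective {G' : Type*} [Group G'] {f : G →* G'}
    (hf : Function.Surjective f) {n : ℕ}
    (h : ⁅(⊤ : Subgroup G), (⊤ : Subgroup G)⁆ ≤ sgPow ⊤ n) :
    ⁅(⊤ : Subgroup G'), (⊤ : Subgroup G')⁆ ≤ sgPow ⊤ n := by
  rw [← map_top_of_surjective f hf, ← map_commutator, ← map_sgPow]
  exact map_mono h

theorem commute_mk_of_commutator_le {R A : Subgroup G} [R.Normal]
    (h : ⁅A, (⊤ : Subgroup G)⁆ ≤ R) {a : G} (ha : a ∈ A) (g : G ⧸ R) : Commute (a : G ⧸ R) g := by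
  induction g using QuotientGroup.induction_on with
  | H g =>
    have h1 : QuotientGroup.mk' R ⁅a, g⁆ = 1 :=
      (QuotientGroup.eq_one_iff _).2 (h (commutator_mem_commutator ha (mem_top g)))
    rw [map_commutatorElement] at h1
    exact commutatorElement_eq_one_iff_commute.1 h1

theorem mem_of_commute_mk {R : Subgroup G} [R.Normal] {a b : G}
    (h : Commute (a : G ⧸ R) (b : G ⧸ R)) : ⁅a, b⁆ ∈ R := by
  rw [← QuotientGroup.eq_one_iff]
  exact (map_commutatorElement (QuotientGroup.mk' R) a b).trans
    (commutatorElement_eq_one_iff_commute.2 h)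

theorem commutator_zpowers_sup_le {N R : Subgroup G} [N.Normal] [R.Normal]
    (h : ⁅N, (⊤ : Subgroup G)⁆ ≤ R) (x : G) : ⁅zpowers x ⊔ N, zpowers x ⊔ N⁆ ≤ R := by
  rw [commutator_le]
  intro g hg g' hg'
  rw [mem_sup_of_normal_right] at hg hg'
  obtain ⟨_, ⟨i, rfl⟩, n, hn, rfl⟩ := hg
  obtain ⟨_, ⟨j, rfl⟩, m, hm, rfl⟩ := hg'
  apply mem_of_commute_mk
  have hn' := commute_mk_of_commutator_le h hn
  have hm' := commute_mk_of_commutator_le h hm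
  have hx : Commute ((x : G ⧸ R) ^ i) ((x : G ⧸ R) ^ j) := Commute.zpow_zpow_self _ i j
  exact (hx.mul_right (hm' _).symm).mul_left (hn' _)

theorem commutator_zpowers_sup_le_sgPow {N : Subgroup G} [N.Normal] {p : ℕ}
    (h : ⁅N, (⊤ : Subgroup G)⁆ ≤ sgPow N p) (x : G) :
    ⁅zpowers x ⊔ N, zpowers x ⊔ N⁆ ≤ sgPow (zpowers x ⊔ N) p :=
  (commutator_zpowers_sup_le h x).trans (sgPow_mono le_sup_right p)

theorem le_of_le_sup_commutator_top [Group.IsNilpotent G] {M T : Subgroup G} [M.Normal]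
    [T.Normal] (h : M ≤ T ⊔ ⁅M, (⊤ : Subgroup G)⁆) : M ≤ T := by
  have key (n : ℕ) : M ≤ T ⊔ (⊤ : Subgroup G).lowerCentralSeries n := by
    induction n with
    | zero => exact le_sup_of_le_right le_top
    | succ n ih =>
      refine h.trans (sup_le le_sup_left ?_)
      rw [commutator_le]
      intro m hm g _
      apply mem_of_commute_mk
      obtain ⟨t, ht, l, hl, rfl⟩ := mem_sup_of_normal_right.1 (ih hm)
      rw [QuotientGroup.mk_mul, (QuotientGroup.eq_one_iff t).2 (mem_sup_left ht), one_mul]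
      exact commute_mk_of_commutator_le (A := (⊤ : Subgroup G).lowerCentralSeries n) le_sup_right hl _
  obtain ⟨n, hn⟩ := Subgroup.nilpotent_iff_lowerCentralSeries.1 ‹Group.IsNilpotent G›
  simpa [hn] using key n

theorem commutator_sgPow_top_le [Group.IsNilpotent G] {p : ℕ} (hp : p.Prime) (hodd : Odd p)
    {N : Subgroup G} [N.Normal] (h : ⁅N, (⊤ : Subgroup G)⁆ ≤ sgPow N p) :
    ⁅sgPow N p, (⊤ : Subgroup G)⁆ ≤ sgPow (sgPow N p) p := by
  apply le_of_le_sup_commutator_top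
  set R := sgPow (sgPow N p) p ⊔ ⁅⁅sgPow N p, (⊤ : Subgroup G)⁆, (⊤ : Subgroup G)⁆
  have hcenter : sgPow N p ≤ (center (G ⧸ R)).comap (QuotientGroup.mk' R) := by
    rw [sgPow_le_iff]
    intro a ha
    rw [mem_comap, mem_center_iff]
    intro g
    induction g using QuotientGroup.induction_on with
    | H g =>
      have hc : ⁅a⁻¹, g⁻¹⁆ ∈ sgPow N p :=
        h (commutator_mem_commutator (inv_mem ha) (mem_top _))
      have hd : ∀ q : G ⧸ R, Commute (⁅⁅(a : G ⧸ R)⁻¹, (g : G ⧸ R)⁻¹⁆, (a : G ⧸ R)⁆) q :=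
        commute_mk_of_commutator_le (a := ⁅⁅a⁻¹, g⁻¹⁆, a⁆) le_sup_right
          (commutator_mem_commutator hc (mem_top _))
      have hcp : ⁅(a : G ⧸ R)⁻¹, (g : G ⧸ R)⁻¹⁆ ^ p = 1 :=
        (QuotientGroup.eq_one_iff (⁅a⁻¹, g⁻¹⁆ ^ p)).2 (mem_sup_left (pow_mem_sgPow hc))
      exact (commute_pow_of_commutator_commute hp hodd (hd _) (hd _) hcp).symm.eq
  rw [commutator_le]
  intro a ha g _
  exact mem_of_commute_mk (mem_center_iff.1 (hcenter ha) g).symm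

end PowerSubgroup

section Powerful

universe u

/-- In a `p`-group, normal maximal subgroups contain all `p`-th powers. -/
theorem pow_mem_of_isCoatom {G : Type*} [Group G] {p : ℕ} (hG : IsPGroup p G)
    {C : Subgroup G} [C.Normal] (hC : IsCoatom C) (g : G) : g ^ p ∈ C := by
  by_contra hg
  have htop : zpowers (g ^ p) ⊔ C = ⊤ :=
    hC.2 _ (right_lt_sup.2 fun h => hg (h (mem_zpowers _)))
  obtain ⟨_, ⟨k, rfl⟩, c, hc, h⟩ := mem_sup_of_normal_right.1 (htop ▸ mem_top g)
  set q : G ⧸ C := (g : G ⧸ C)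
  have h1 : (q ^ p) ^ k = q := by
    have := congrArg (QuotientGroup.mk' C) h
    rw [map_mul, map_zpow, map_pow] at this
    rwa [show QuotientGroup.mk' C c = 1 from (QuotientGroup.eq_one_iff c).2 hc, mul_one] at this
  have h2 : q ^ ((p : ℤ) * k - 1) = 1 := by
    rw [zpow_sub, zpow_mul, zpow_natCast, h1, zpow_one, mul_inv_cancel]
  obtain ⟨m, hm⟩ := isPGroup_iff_pow_pow_eq_one.1 (hG.to_quotient C) q
  have hcop : IsCoprime ((p : ℤ) ^ m) ((p : ℤ) * k - 1) :=
    IsCoprime.pow_left ⟨k, -1, by ring⟩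
  have h3 : (orderOf q : ℤ) ∣ (p : ℤ) ^ m := by exact_mod_cast orderOf_dvd_of_pow_eq_one hm
  have h4 := hcop.isUnit_of_dvd' h3 (orderOf_dvd_iff_zpow_eq_one.2 h2)
  have h5 : q = 1 := orderOf_eq_one_iff.1 (by simpa [Int.isUnit_iff] using h4)
  exact hg (C.pow_mem ((QuotientGroup.eq_one_iff g).1 h5) p)

theorem commute_of_zpowers_sup_sgPow_eq_top {G : Type*} [Group G] [Finite G] {p : ℕ}
    (hp : p.Prime) (hG : IsPGroup p G) {x : G}
    (h : zpowers x ⊔ sgPow (⊤ : Subgroup G) p = ⊤) (a b : G) : Commute a b := by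
  have := Fact.mk hp
  have := hG.isNilpotent
  have hx : zpowers x = ⊤ := by
    apply frattini_nongenerating
    rw [eq_top_iff, ← h]
    refine sup_le_sup_left ?_ _
    rw [sgPow_le_iff]
    intro g _
    simp only [frattini, Order.radical, mem_iInf]
    intro C hC
    have := Group.normalizerCondition_of_isNilpotent.normal_of_coatom C hC
    exact pow_mem_of_isCoatom hG hC g
  obtain ⟨i, rfl⟩ : a ∈ zpowers x := hx ▸ mem_top a
  obtain ⟨j, rfl⟩ : b ∈ zpowers x := hx ▸ mem_top b
  exact Commute.zpow_zpow_self x i j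

/-- In a powerful `p`-group with `p` odd, every element of the subgroup generated by the `p`-th
powers is itself a `p`-th power. -/
theorem exists_pow_eq_of_mem_sgPow_top {p : ℕ} (hp : p.Prime) (hodd : Odd p) {G : Type u}
    [Group G] [Finite G] (hG : IsPGroup p G)
    (hpow : ⁅(⊤ : Subgroup G), (⊤ : Subgroup G)⁆ ≤ sgPow ⊤ p) {g : G}
    (hg : g ∈ sgPow (⊤ : Subgroup G) p) : ∃ a, a ^ p = g := by
  induction hn : Nat.card G using Nat.strong_induction_on generalizing G with
  | _ n ih =>
  subst hn
  have := Fact.mk hp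
  have := hG.isNilpotent
  have hle := commutator_sgPow_top_le hp hodd hpow
  set P := sgPow (⊤ : Subgroup G) p with hP
  have hcoset : ∃ a, (QuotientGroup.mk (a ^ p) : G ⧸ sgPow P p) = g := by
    induction hg using closure_induction with
    | mem x hx =>
      obtain ⟨a, _, rfl⟩ := hx
      exact ⟨a, rfl⟩
    | one => exact ⟨1, by simp⟩
    | mul x y _ _ hx hy =>
      obtain ⟨a, ha⟩ := hx
      obtain ⟨b, hb⟩ := hy
      have hc : ⁅b, a⁆ ∈ P := hpow (commutator_mem_commutator (mem_top b) (mem_top a))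
      have hcomm : ∀ q : G ⧸ sgPow P p, Commute ⁅(b : G ⧸ sgPow P p), (a : G ⧸ sgPow P p)⁆ q :=
        commute_mk_of_commutator_le hle hc
      refine ⟨a * b, ?_⟩
      rw [QuotientGroup.mk_mul, ← ha, ← hb]
      exact mul_pow_eq_of_commutator_pow_eq_one hp hodd (hcomm _) (hcomm _)
        ((QuotientGroup.eq_one_iff (⁅b, a⁆ ^ p)).2 (pow_mem_sgPow hc))
    | inv x _ hx =>
      obtain ⟨a, ha⟩ := hx
      exact ⟨a⁻¹, by rw [inv_pow, QuotientGroup.mk_inv, ha, QuotientGroup.mk_inv]⟩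
  obtain ⟨a, ha⟩ := hcoset
  have hmem : (a ^ p)⁻¹ * g ∈ sgPow P p := QuotientGroup.eq.1 ha
  set H := zpowers a ⊔ P
  have hgH : g ∈ sgPow H p := by
    rw [← mul_inv_cancel_left (a ^ p) g]
    exact mul_mem (pow_mem_sgPow (mem_sup_left (mem_zpowers a))) (sgPow_mono le_sup_right p hmem)
  by_cases htop : H = ⊤
  · have hcomm := commute_of_zpowers_sup_sgPow_eq_top hp hG htop
    clear ha hmem hgH
    induction hg using closure_induction with
    | mem x hx =>
      obtain ⟨a, _, rfl⟩ := hx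
      exact ⟨a, rfl⟩
    | one => exact ⟨1, one_pow p⟩
    | mul x y _ _ hx hy =>
      obtain ⟨a, rfl⟩ := hx
      obtain ⟨b, rfl⟩ := hy
      exact ⟨a * b, (hcomm a b).mul_pow p⟩
    | inv x _ hx =>
      obtain ⟨a, rfl⟩ := hx
      exact ⟨a⁻¹, inv_pow a p⟩
  · rw [← map_subtype_sgPow_top] at hgH
    obtain ⟨h, hh, rfl⟩ := hgH
    obtain ⟨b, hb⟩ := ih (Nat.card H) (lt_of_le_of_ne (card_le_card_group H) fun h => htop (eq_top_of_card_eq H h)) (hG.to_subgroup H)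
      (commutator_top_le_sgPow_of_le (commutator_zpowers_sup_le_sgPow hle a)) hh rfl
    exact ⟨b, by rw [← hb]; rfl⟩

theorem exists_pow_eq_of_mem_sgPow {p : ℕ} (hp : p.Prime) (hodd : Odd p) {G : Type*}
    [Group G] [Finite G] (hG : IsPGroup p G) {H : Subgroup G} (hH : ⁅H, H⁆ ≤ sgPow H p) {g : G}
    (hg : g ∈ sgPow H p) : ∃ a ∈ H, a ^ p = g := by
  rw [← map_subtype_sgPow_top] at hg
  obtain ⟨h, hh, rfl⟩ := hg
  obtain ⟨b, hb⟩ := exists_pow_eq_of_mem_sgPow_top hp hodd (hG.to_subgroup H)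
    (commutator_top_le_sgPow_of_le hH) hh
  exact ⟨b, b.2, by rw [← hb]; rfl⟩

/-- Properties of the elements of order dividing `p` in a subgroup `K`, which hold when `K` is a
powerful `p`-group with `p` odd. -/
structure IsOmegaRegular (p : ℕ) {G : Type*} [Group G] (K : Subgroup G) : Prop where
  mul_pow_eq_one : ∀ x ∈ K, ∀ y ∈ K, x ^ p = 1 → y ^ p = 1 → (x * y) ^ p = 1
  commute_of_mem_sgPow : ∀ x ∈ sgPow K p, ∀ z ∈ K, x ^ p = 1 → z ^ p = 1 → Commute x z
  commute_of_mem_sgPow_sgPow :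
    ∀ x ∈ sgPow (sgPow K p) p, ∀ z ∈ K, x ^ p = 1 → (z ^ p) ^ p = 1 → Commute x z

namespace IsOmegaRegular

theorem of_top {p : ℕ} {G : Type*} [Group G] {K : Subgroup G}
    (h : IsOmegaRegular p (⊤ : Subgroup K)) : IsOmegaRegular p K where
  mul_pow_eq_one x hx y hy hxp hyp := by
    have := h.mul_pow_eq_one ⟨x, hx⟩ (mem_top _) ⟨y, hy⟩ (mem_top _) (Subtype.ext hxp)
      (Subtype.ext hyp)
    exact congrArg Subtype.val this
  commute_of_mem_sgPow x hx z hz hxp hzp := by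
    rw [← map_subtype_sgPow_top] at hx
    obtain ⟨x, hx, rfl⟩ := hx
    exact (h.commute_of_mem_sgPow x hx ⟨z, hz⟩ (mem_top _) (Subtype.ext hxp)
      (Subtype.ext hzp)).map K.subtype
  commute_of_mem_sgPow_sgPow x hx z hz hxp hzp := by
    rw [← map_subtype_sgPow_top K, ← map_sgPow] at hx
    obtain ⟨x, hx, rfl⟩ := hx
    exact (h.commute_of_mem_sgPow_sgPow x hx ⟨z, hz⟩ (mem_top _) (Subtype.ext hxp)
      (Subtype.ext hzp)).map K.subtype

/-- The elements of order dividing `p` in a subgroup where they are closed under products. -/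
def omegaOne {p : ℕ} {G : Type*} [Group G] {K : Subgroup G} (h : IsOmegaRegular p K) :
    Subgroup G where
  carrier := {x | x ∈ K ∧ x ^ p = 1}
  one_mem' := ⟨K.one_mem, one_pow p⟩
  mul_mem' hx hy := ⟨K.mul_mem hx.1 hy.1, h.mul_pow_eq_one _ hx.1 _ hy.1 hx.2 hy.2⟩
  inv_mem' hx := ⟨K.inv_mem hx.1, by rw [inv_pow, hx.2, inv_one]⟩

theorem omegaOne_normal {p : ℕ} {G : Type*} [Group G] {K : Subgroup G} [hK : K.Normal]
    (h : IsOmegaRegular p K) : h.omegaOne.Normal where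
  conj_mem x hx g := ⟨hK.conj_mem x hx.1 g, by rw [conj_pow, hx.2, mul_one, mul_inv_cancel]⟩

end IsOmegaRegular

theorem commutatorElement_pow_eq_one {p : ℕ} {G : Type*} [Group G] {K : Subgroup G}
    [hKn : K.Normal] (hK : IsOmegaRegular p K) {c : G} (hc : c ∈ K) (hcp : c ^ p = 1) (g : G) :
    ⁅c, g⁆ ^ p = 1 := by
  have hc' : c ∈ hK.omegaOne := ⟨hc, hcp⟩
  have := hK.omegaOne_normal
  exact (commutator_le_left hK.omegaOne ⊤ (commutator_mem_commutator hc' (mem_top g))).2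

/-- In a finite powerful `p`-group with `p` odd, the product of two elements of order dividing `p`
has order dividing `p`, and `p ^ j`-th powers of order dividing `p` commute with elements of order
dividing `p ^ j`, for `j = 1` and `j = 2`. -/
theorem isOmegaRegular_top {p : ℕ} (hp : p.Prime) (hodd : Odd p) {G : Type u}
    [Group G] [Finite G] (hG : IsPGroup p G)
    (hpow : ⁅(⊤ : Subgroup G), (⊤ : Subgroup G)⁆ ≤ sgPow ⊤ p) :
    IsOmegaRegular p (⊤ : Subgroup G) := by
  induction hn : Nat.card G using Nat.strong_induction_on generalizing G with
  | _ n ih =>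
  subst hn
  have := Fact.mk hp
  have := hG.isNilpotent
  by_cases hab : ∀ a b : G, Commute a b
  · exact ⟨fun x _ y _ hx hy => by rw [(hab x y).mul_pow, hx, hy, mul_one],
      fun x _ z _ _ _ => hab x z, fun x _ z _ _ _ => hab x z⟩
  have hle1 := commutator_sgPow_top_le hp hodd hpow
  have hle2 := commutator_sgPow_top_le hp hodd hle1
  set P := sgPow (⊤ : Subgroup G) p with hP
  have hPpow : ⁅P, P⁆ ≤ sgPow P p := (commutator_mono le_rfl le_top).trans hle1
  have hsub (z : G) : IsOmegaRegular p (zpowers z ⊔ P) ∧ (zpowers z ⊔ P).Normal :=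
    ⟨.of_top <| ih _ (lt_of_le_of_ne (card_le_card_group _) fun h => hab
        (commute_of_zpowers_sup_sgPow_eq_top hp hG (eq_top_of_card_eq _ h))) (hG.to_subgroup _)
        (commutator_top_le_sgPow_of_le (commutator_zpowers_sup_le_sgPow hle1 z)) rfl,
      Subgroup.Normal.of_commutator_le G (hpow.trans le_sup_right)⟩
  have h2 (x : G) (hx : x ∈ sgPow P p) (z : G) (hxp : x ^ p = 1) (hzp : (z ^ p) ^ p = 1) :
      Commute x z := by
    obtain ⟨hK, hKn⟩ := hsub z
    set K := zpowers z ⊔ P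
    have hPK : P ≤ K := le_sup_right
    have hzK : z ∈ K := mem_sup_left (mem_zpowers z)
    obtain ⟨y, hy, rfl⟩ := exists_pow_eq_of_mem_sgPow hp hodd hG hPpow hx
    rcases eq_or_ne (y ^ p) 1 with h1 | h1
    · rw [h1]
      exact Commute.one_left z
    have := hK.omegaOne_normal
    have hX : y ^ p ∈ hK.omegaOne := ⟨K.pow_mem (hPK hy) p, hxp⟩
    have hZ : z ^ p ∈ hK.omegaOne := ⟨K.pow_mem hzK p, hzp⟩
    have hcard : Nat.card (G ⧸ hK.omegaOne) < Nat.card G := by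
      rw [card_eq_card_quotient_mul_card_subgroup hK.omegaOne]
      refine lt_mul_of_one_lt_right Nat.card_pos ?_
      rw [one_lt_card_iff_ne_bot]
      intro h
      exact h1 (mem_bot.1 (h ▸ hX))
    have hQ := ih _ hcard (hG.to_quotient _)
      (commutator_top_le_sgPow_of_surjective (QuotientGroup.mk'_surjective hK.omegaOne) hpow) rfl
    have hyQ : (y : G ⧸ hK.omegaOne) ∈ sgPow (⊤ : Subgroup (G ⧸ hK.omegaOne)) p := by
      have := mem_map_of_mem (QuotientGroup.mk' hK.omegaOne) hy
      rwa [hP, map_sgPow, map_top_of_surjective _ (QuotientGroup.mk'_surjective _)] at this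
    have hyz : Commute (y : G ⧸ hK.omegaOne) (z : G ⧸ hK.omegaOne) :=
      hQ.commute_of_mem_sgPow _ hyQ _ (mem_top _) ((QuotientGroup.eq_one_iff (y ^ p)).2 hX)
        ((QuotientGroup.eq_one_iff (z ^ p)).2 hZ)
    have hc : ⁅y⁻¹, z⁻¹⁆ ∈ hK.omegaOne :=
      mem_of_commute_mk (a := y⁻¹) (b := z⁻¹) hyz.inv_inv
    have hc2 : ⁅y⁻¹, z⁻¹⁆ ∈ sgPow P p :=
      hle1 (commutator_mem_commutator (inv_mem hy) (mem_top _))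
    have hd : ⁅⁅y⁻¹, z⁻¹⁆, y⁆ ∈ sgPow (sgPow K p) p :=
      sgPow_mono (sgPow_mono hPK p) p (hle2 (commutator_mem_commutator hc2 (mem_top _)))
    have hdp := commutatorElement_pow_eq_one hK hc.1 hc.2 y
    exact commute_pow_of_commutator_commute hp hodd
      (hK.commute_of_mem_sgPow_sgPow _ hd _ (hPK hy) hdp hxp)
      (hK.commute_of_mem_sgPow _ (sgPow_le _ p hd) _ hc.1 hdp hc.2) hc.2
  have h1 (x : G) (hx : x ∈ P) (z : G) (hxp : x ^ p = 1) (hzp : z ^ p = 1) : Commute x z := by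
    obtain ⟨hK, hKn⟩ := hsub z
    set K := zpowers z ⊔ P
    have hPK : P ≤ K := le_sup_right
    have hzK : z ∈ K := mem_sup_left (mem_zpowers z)
    obtain ⟨y, rfl⟩ := exists_pow_eq_of_mem_sgPow_top hp hodd hG hpow hx
    have hc1 : ⁅y⁻¹, z⁻¹⁆ ∈ P := hpow (commutator_mem_commutator (mem_top _) (mem_top _))
    have hcp : ⁅y⁻¹, z⁻¹⁆ ^ p = 1 := by
      rw [← commutatorElement_inv, inv_pow,
        commutatorElement_pow_eq_one hK (inv_mem hzK) (by rw [inv_pow, hzp, inv_one]), inv_one]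
    have hd : ⁅⁅y⁻¹, z⁻¹⁆, y⁆ ∈ sgPow P p :=
      hle1 (commutator_mem_commutator hc1 (mem_top _))
    have hdp := commutatorElement_pow_eq_one hK (hPK hc1) hcp y
    exact commute_pow_of_commutator_commute hp hodd (h2 _ hd _ hdp hxp)
      (hK.commute_of_mem_sgPow _ (sgPow_mono hPK p hd) _ (hPK hc1) hdp hcp) hcp
  refine ⟨fun x _ y _ hxp hyp => ?_, fun x hx z _ => h1 x hx z, fun x hx z _ => h2 x hx z⟩
  obtain ⟨hK, hKn⟩ := hsub y
  have hc : ⁅y, x⁆ ∈ P := hpow (commutator_mem_commutator (mem_top _) (mem_top _))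
  have hcp : ⁅y, x⁆ ^ p = 1 :=
    commutatorElement_pow_eq_one hK (mem_sup_left (mem_zpowers y)) hyp x
  rw [mul_pow_eq_of_commutator_pow_eq_one hp hodd (h1 _ hc _ hcp hxp) (h1 _ hc _ hcp hyp) hcp,
    hxp, hyp, mul_one]

end Powerful

end OmegaSubgroups

/-- if G is a powerful p-group (p odd), N ≤ G^p with N of exponent at most p²,
and x, y ∈ N satisfy xᵖ = 1 and yᵖ = 1, then x and y commute. -/
theorem stmt12 {G : Type*} [Group G] [Finite G] (p : ℕ) (hp : p.Prime) (hodd : Odd p)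
    (hpG : IsPGroup p G)
    (hpowerful : ⁅(⊤ : Subgroup G), (⊤ : Subgroup G)⁆ ≤ sgPow ⊤ p)
    (N : Subgroup G) (hNle : N ≤ sgPow ⊤ p)
    (hexp : ∀ n ∈ N, n ^ p ^ 2 = 1)
    (x y : G) (hx : x ∈ N) (hy : y ∈ N) (hxp : x ^ p = 1) (hyp : y ^ p = 1) :
    Commute x y := by
  exact (isOmegaRegular_top hp hodd hpG hpowerful).commute_of_mem_sgPow x (hNle hx) y
    (Subgroup.mem_top y) hxp hyp
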